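/- Let H = N⋊T be the smash product of cocommutative Hopf algebras N and T over a field k, acting trivially on the commutative k-algebra A. The map π: H → T, π(n⋊t) = ε(n)t, is a Hopf algebra map splitting the inclusion T → H, and for i = 2 and i = 3 the induced splitting of the restriction map yields a direct sum decomposition H^i(H,A) ≅ H^i(T,A) ⊕ H̃^i(H,A) of Sweedler cohomology groups. -/

import Mathlib

open TensorProduct

namespace SmashPaper

variable (k : Type) [Field k]

section Conv

variable {k : Type} [Field k] {C A : Type} [AddCommGroup C] [Module k C] [Coalgebra k C]
  [CommRing A] [Algebra k A]

/-- Convolution product on linear maps from a coalgebra to an algebra. -/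
noncomputable def conv (f g : C →ₗ[k] A) : C →ₗ[k] A :=
  LinearMap.mul' k A ∘ₗ TensorProduct.map f g ∘ₗ Coalgebra.comul

/-- Convolution unit. -/
noncomputable def convOne (C A : Type) [AddCommGroup C] [Module k C] [Coalgebra k C]
    [CommRing A] [Algebra k A] : C →ₗ[k] A :=
  Algebra.linearMap k A ∘ₗ Coalgebra.counit

def IsConvInv (f g : C →ₗ[k] A) : Prop :=
  conv f g = convOne C A ∧ conv g f = convOne C A

def IsConvInvertible (f : C →ₗ[k] A) : Prop := ∃ g, IsConvInv f g

end Conv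

/-- Cocommutativity of a coalgebra. -/
def IsCocomm (C : Type) [AddCommGroup C] [Module k C] [Coalgebra k C] : Prop :=
  (TensorProduct.comm k C C).toLinearMap ∘ₗ Coalgebra.comul
    = (Coalgebra.comul : C →ₗ[k] C ⊗[k] C)

section Drop

variable {k : Type} [Field k] (C D : Type) [AddCommGroup C] [Module k C]
  [AddCommGroup D] [Module k D]

/-- `c ⊗ d ↦ ε(c) d`. -/
noncomputable def dropL [Coalgebra k C] : C ⊗[k] D →ₗ[k] D :=
  (TensorProduct.lid k D).toLinearMap ∘ₗ LinearMap.rTensor D (Coalgebra.counit (R := k))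

/-- `c ⊗ d ↦ ε(d) c`. -/
noncomputable def dropR [Coalgebra k D] : C ⊗[k] D →ₗ[k] C :=
  (TensorProduct.rid k C).toLinearMap ∘ₗ LinearMap.lTensor C (Coalgebra.counit (R := k))

end Drop

section Sweedler

variable {k : Type} [Field k] (H A : Type) [Ring H] [Bialgebra k H]
  [CommRing A] [Algebra k A]

variable {H A}

/-- Normalization for 1-cochains. -/
def Normalized1 (t : H →ₗ[k] A) : Prop := t 1 = 1

/-- Normalization for 2-cochains: trivial whenever an argument is a scalar. -/
def Normalized2 (f : H ⊗[k] H →ₗ[k] A) : Prop :=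
  ∀ x : H, f (1 ⊗ₜ[k] x) = algebraMap k A (Coalgebra.counit x)
    ∧ f (x ⊗ₜ[k] 1) = algebraMap k A (Coalgebra.counit x)

/-- Normalization for 3-cochains. -/
def Normalized3 (f : (H ⊗[k] H) ⊗[k] H →ₗ[k] A) : Prop :=
  ∀ x y : H,
    f ((1 ⊗ₜ[k] x) ⊗ₜ[k] y) = algebraMap k A (Coalgebra.counit x * Coalgebra.counit y)
    ∧ f ((x ⊗ₜ[k] 1) ⊗ₜ[k] y) = algebraMap k A (Coalgebra.counit x * Coalgebra.counit y)
    ∧ f ((x ⊗ₜ[k] y) ⊗ₜ[k] 1) = algebraMap k A (Coalgebra.counit x * Coalgebra.counit y)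

/-- `∑ f(x₍₁₎ ⊗ y₍₁₎) f(x₍₂₎y₍₂₎ ⊗ z)` as a linear map on `(H ⊗ H) ⊗ H`. -/
noncomputable def cocycle2LHS (f : H ⊗[k] H →ₗ[k] A) : (H ⊗[k] H) ⊗[k] H →ₗ[k] A :=
  conv (f ∘ₗ dropR (H ⊗[k] H) H) (f ∘ₗ LinearMap.rTensor H (LinearMap.mul' k H))

/-- `∑ f(y₍₁₎ ⊗ z₍₁₎) f(x ⊗ y₍₂₎z₍₂₎)` as a linear map on `(H ⊗ H) ⊗ H`. -/
noncomputable def cocycle2RHS (f : H ⊗[k] H →ₗ[k] A) : (H ⊗[k] H) ⊗[k] H →ₗ[k] A :=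
  conv (f ∘ₗ dropL H (H ⊗[k] H) ∘ₗ (TensorProduct.assoc k H H H).toLinearMap)
       (f ∘ₗ LinearMap.lTensor H (LinearMap.mul' k H) ∘ₗ (TensorProduct.assoc k H H H).toLinearMap)

/-- Sweedler 2-cocycles (for the trivial action). -/
def IsZ2 (f : H ⊗[k] H →ₗ[k] A) : Prop :=
  Normalized2 f ∧ IsConvInvertible f ∧ cocycle2LHS f = cocycle2RHS f

/-- The Sweedler 2-coboundary `∑ t(y₍₁₎) t⁻¹(x₍₁₎y₍₂₎) t(x₍₂₎)` of a 1-cochain `t`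
with convolution inverse `tinv`. -/
noncomputable def cobound2 (t tinv : H →ₗ[k] A) : H ⊗[k] H →ₗ[k] A :=
  conv (t ∘ₗ dropL H H) (conv (tinv ∘ₗ LinearMap.mul' k H) (t ∘ₗ dropR H H))

/-- Sweedler 2-coboundaries (for the trivial action). -/
def IsB2 (f : H ⊗[k] H →ₗ[k] A) : Prop :=
  ∃ t tinv : H →ₗ[k] A, Normalized1 t ∧ IsConvInv t tinv ∧ f = cobound2 t tinv

/-- Two 2-cochains are cohomologous when they differ (in convolution) by a 2-coboundary. -/
def Cohomologous2 (f f' : H ⊗[k] H →ₗ[k] A) : Prop :=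
  ∃ b, IsB2 b ∧ f = conv f' b

/-- `(x⊗y)⊗z ↦ x ⊗ yz`. -/
noncomputable def m23 : (H ⊗[k] H) ⊗[k] H →ₗ[k] H ⊗[k] H :=
  LinearMap.lTensor H (LinearMap.mul' k H) ∘ₗ (TensorProduct.assoc k H H H).toLinearMap

/-- `(x⊗y)⊗z ↦ ε(x) (y⊗z)`. -/
noncomputable def p23 : (H ⊗[k] H) ⊗[k] H →ₗ[k] H ⊗[k] H :=
  dropL H (H ⊗[k] H) ∘ₗ (TensorProduct.assoc k H H H).toLinearMap

/-- 3-cocycle condition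
`∑ f(y₁⊗z₁⊗w₁) f(x₁⊗y₂z₂⊗w₂) f(x₂⊗y₃⊗z₃) = ∑ f(x₁y₁⊗z₁⊗w₁) f(x₂⊗y₂⊗z₂w₂)`. -/
def IsZ3cond (f : (H ⊗[k] H) ⊗[k] H →ₗ[k] A) : Prop :=
  conv (f ∘ₗ LinearMap.rTensor H (LinearMap.rTensor H (dropL H H)))
    (conv (f ∘ₗ LinearMap.rTensor H (m23 (H := H)))
          (f ∘ₗ dropR ((H ⊗[k] H) ⊗[k] H) H))
  = conv (C := ((H ⊗[k] H) ⊗[k] H) ⊗[k] H)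
         (f ∘ₗ LinearMap.rTensor H (LinearMap.rTensor H (LinearMap.mul' k H)))
         (f ∘ₗ (LinearMap.lTensor (H ⊗[k] H) (LinearMap.mul' k H)
              ∘ₗ (TensorProduct.assoc k (H ⊗[k] H) H H).toLinearMap :
                ((H ⊗[k] H) ⊗[k] H) ⊗[k] H →ₗ[k] (H ⊗[k] H) ⊗[k] H))

/-- Sweedler 3-cocycles (for the trivial action). -/
def IsZ3 (f : (H ⊗[k] H) ⊗[k] H →ₗ[k] A) : Prop :=
  Normalized3 f ∧ IsConvInvertible f ∧ IsZ3cond f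

/-- The Sweedler 3-coboundary
`∑ v(y₁⊗z₁) v⁻¹(x₁y₂⊗z₂) v(x₂⊗y₃z₃) v⁻¹(x₃⊗y₄)` of a 2-cochain `v`. -/
noncomputable def cobound3 (v vinv : H ⊗[k] H →ₗ[k] A) : (H ⊗[k] H) ⊗[k] H →ₗ[k] A :=
  conv (v ∘ₗ p23 (H := H))
    (conv (vinv ∘ₗ LinearMap.rTensor H (LinearMap.mul' k H))
      (conv (v ∘ₗ m23 (H := H)) (vinv ∘ₗ dropR (H ⊗[k] H) H)))

/-- Sweedler 3-coboundaries (for the trivial action). -/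
def IsB3 (f : (H ⊗[k] H) ⊗[k] H →ₗ[k] A) : Prop :=
  ∃ v vinv : H ⊗[k] H →ₗ[k] A, Normalized2 v ∧ IsConvInv v vinv ∧ f = cobound3 v vinv

/-- Cohomologous 3-cochains. -/
def Cohomologous3 (f f' : (H ⊗[k] H) ⊗[k] H →ₗ[k] A) : Prop :=
  ∃ b, IsB3 b ∧ f = conv f' b

end Sweedler

section Measuring

variable {k : Type} [Field k]
variable {C : Type} [AddCommGroup C] [Module k C] [Coalgebra k C]
variable {N : Type} [Ring N] [Bialgebra k N]
variable {A : Type} [CommRing A] [Algebra k A]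

/-- `(C, θ)` measures `N` to `A`:
`∑ θ(c₍₁₎ ⊗ n) θ(c₍₂₎ ⊗ n') = θ(c ⊗ nn')` and `θ(c ⊗ 1) = ε(c) 1`. -/
def Measures (θ : C ⊗[k] N →ₗ[k] A) : Prop :=
  (θ ∘ₗ LinearMap.lTensor C (LinearMap.mul' k N)
    = conv (θ ∘ₗ LinearMap.lTensor C (dropR N N)) (θ ∘ₗ LinearMap.lTensor C (dropL N N)))
  ∧ ∀ c : C, θ (c ⊗ₜ[k] (1 : N)) = algebraMap k A (Coalgebra.counit c)

end Measuring

section Action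

variable {k : Type} [Field k]
variable {T N : Type} [Ring T] [Bialgebra k T] [Ring N] [Bialgebra k N]

/-- `μ : T ⊗ N → N` makes `N` a left `T`-module bialgebra. -/
structure IsModuleBialgebra (μ : T ⊗[k] N →ₗ[k] N) : Prop where
  one_act : ∀ n : N, μ ((1 : T) ⊗ₜ[k] n) = n
  mul_act : ∀ (t s : T) (n : N), μ ((t * s) ⊗ₜ[k] n) = μ (t ⊗ₜ[k] μ (s ⊗ₜ[k] n))
  act_one : ∀ t : T, μ (t ⊗ₜ[k] (1 : N)) = algebraMap k N (Coalgebra.counit t)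
  act_mul : μ ∘ₗ LinearMap.lTensor T (LinearMap.mul' k N)
      = LinearMap.mul' k N ∘ₗ TensorProduct.map μ μ
          ∘ₗ (TensorProduct.tensorTensorTensorComm k T T N N).toLinearMap
          ∘ₗ LinearMap.rTensor (N ⊗[k] N) Coalgebra.comul
  comul_act : Coalgebra.comul ∘ₗ μ
      = TensorProduct.map μ μ
          ∘ₗ (TensorProduct.tensorTensorTensorComm k T T N N).toLinearMap
          ∘ₗ TensorProduct.map Coalgebra.comul Coalgebra.comul
  counit_act : ∀ (t : T) (n : N),
      Coalgebra.counit (R := k) (μ (t ⊗ₜ[k] n))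
        = Coalgebra.counit (R := k) t * Coalgebra.counit (R := k) n

/-- `t ⊗ n ↦ ∑ t₍₁₎(n) ⊗ t₍₂₎`. -/
noncomputable def smashCross (μ : T ⊗[k] N →ₗ[k] N) : T ⊗[k] N →ₗ[k] N ⊗[k] T :=
  TensorProduct.map μ LinearMap.id
    ∘ₗ (TensorProduct.assoc k T N T).symm.toLinearMap
    ∘ₗ LinearMap.lTensor T (TensorProduct.comm k T N).toLinearMap
    ∘ₗ (TensorProduct.assoc k T T N).toLinearMap
    ∘ₗ LinearMap.rTensor N Coalgebra.comul

variable {H : Type} [Ring H] [Bialgebra k H]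

/-- `H` is the smash product `N ⋊ T` along the action `μ`, with `N` and `T` included
as the Hopf subalgebras `N ⋊ 1` and `1 ⋊ T`; we identify `n ⋊ t = n t`. -/
structure IsSmashProduct (μ : T ⊗[k] N →ₗ[k] N) (iN : N →ₐc[k] H) (iT : T →ₐc[k] H) : Prop where
  act : IsModuleBialgebra μ
  injN : Function.Injective iN
  injT : Function.Injective iT
  /-- `n ⊗ t ↦ (n ⋊ 1)(1 ⋊ t)` is a linear isomorphism `N ⊗ T ≅ H` (`H` is the
  tensor product coalgebra `N ⊗ T`). -/
  bij : Function.Bijective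
    (LinearMap.mul' k H ∘ₗ TensorProduct.map (iN : N →ₗ[k] H) (iT : T →ₗ[k] H))
  /-- The smash relation `t n = ∑ t₍₁₎(n) t₍₂₎` in `H`. -/
  straighten : LinearMap.mul' k H ∘ₗ TensorProduct.map (iT : T →ₗ[k] H) (iN : N →ₗ[k] H)
      = LinearMap.mul' k H ∘ₗ TensorProduct.map (iN : N →ₗ[k] H) (iT : T →ₗ[k] H)
          ∘ₗ smashCross μ

end Action

section MeasCohomology

variable {k : Type} [Field k]
variable {T N : Type} [Ring T] [Bialgebra k T] [Ring N] [Bialgebra k N]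
variable {A : Type} [CommRing A] [Algebra k A]

/-- Normalization in the `T`-variable for measuring 1-cochains `T ⊗ N → A`. -/
def MeasNormalized1 (f : T ⊗[k] N →ₗ[k] A) : Prop :=
  ∀ n : N, f ((1 : T) ⊗ₜ[k] n) = algebraMap k A (Coalgebra.counit n)

/-- A measuring 1-cochain: an element of `Reg_meas(T, Hom(N,A))`. -/
def IsRegMeas1 (f : T ⊗[k] N →ₗ[k] A) : Prop :=
  Measures f ∧ MeasNormalized1 f ∧ IsConvInvertible f

/-- The measuring 1-cocycle condition `f(ts)(n) = ∑ f(s₍₁₎)(n₍₁₎) f(t)(s₍₂₎(n₍₂₎))`. -/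
def MeasCocycle1 (μ : T ⊗[k] N →ₗ[k] N) (f : T ⊗[k] N →ₗ[k] A) : Prop :=
  f ∘ₗ LinearMap.rTensor N (LinearMap.mul' k T)
    = conv (f ∘ₗ LinearMap.rTensor N (dropL T T))
      (f ∘ₗ LinearMap.lTensor T μ ∘ₗ (TensorProduct.assoc k T T N).toLinearMap)

/-- Measuring 1-cocycles. -/
def IsMeasZ1 (μ : T ⊗[k] N →ₗ[k] N) (f : T ⊗[k] N →ₗ[k] A) : Prop :=
  IsRegMeas1 f ∧ MeasCocycle1 μ f

/-- Measuring 1-coboundaries: `f(t)(n) = ∑ g(n₍₁₎) g⁻¹(t(n₍₂₎))` for a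
convolution-invertible algebra map `g : N → A`. -/
def IsMeasB1 (μ : T ⊗[k] N →ₗ[k] N) (f : T ⊗[k] N →ₗ[k] A) : Prop :=
  ∃ (g : N →ₐ[k] A) (ginv : N →ₗ[k] A), IsConvInv g.toLinearMap ginv ∧
    f = conv (g.toLinearMap ∘ₗ dropL T N) (ginv ∘ₗ μ)

/-- Normalization for measuring 2-cochains `(T ⊗ T) ⊗ N → A`. -/
def MeasNormalized2 (f : (T ⊗[k] T) ⊗[k] N →ₗ[k] A) : Prop :=
  ∀ (t : T) (n : N),
    f (((1 : T) ⊗ₜ[k] t) ⊗ₜ[k] n)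
        = algebraMap k A (Coalgebra.counit t * Coalgebra.counit n)
    ∧ f ((t ⊗ₜ[k] (1 : T)) ⊗ₜ[k] n)
        = algebraMap k A (Coalgebra.counit t * Coalgebra.counit n)

/-- A measuring 2-cochain: an element of `Reg_meas(T ⊗ T, Hom(N,A))`. -/
def IsRegMeas2 (f : (T ⊗[k] T) ⊗[k] N →ₗ[k] A) : Prop :=
  Measures f ∧ MeasNormalized2 f ∧ IsConvInvertible f

/-- The measuring 2-cocycle condition
`∑ f(t₍₁₎⊗s₍₁₎)(r₍₁₎(n₍₁₎)) f(t₍₂₎s₍₂₎⊗r₍₂₎)(n₍₂₎) = ∑ f(s₍₁₎⊗r₍₁₎)(n₍₁₎) f(t⊗s₍₂₎r₍₂₎)(n₍₂₎)`. -/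
def MeasCocycle2 (μ : T ⊗[k] N →ₗ[k] N) (f : (T ⊗[k] T) ⊗[k] N →ₗ[k] A) : Prop :=
  conv (C := ((T ⊗[k] T) ⊗[k] T) ⊗[k] N)
       (f ∘ₗ (LinearMap.lTensor (T ⊗[k] T) μ
          ∘ₗ (TensorProduct.assoc k (T ⊗[k] T) T N).toLinearMap :
            ((T ⊗[k] T) ⊗[k] T) ⊗[k] N →ₗ[k] (T ⊗[k] T) ⊗[k] N))
       (f ∘ₗ LinearMap.rTensor N (LinearMap.rTensor T (LinearMap.mul' k T)))
    = conv (C := ((T ⊗[k] T) ⊗[k] T) ⊗[k] N)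
           (f ∘ₗ LinearMap.rTensor N (LinearMap.rTensor T (dropL T T)))
           (f ∘ₗ LinearMap.rTensor N
              ((LinearMap.lTensor T (LinearMap.mul' k T)
                ∘ₗ (TensorProduct.assoc k T T T).toLinearMap :
                  (T ⊗[k] T) ⊗[k] T →ₗ[k] T ⊗[k] T)))

/-- Measuring 2-cocycles. -/
def IsMeasZ2 (μ : T ⊗[k] N →ₗ[k] N) (f : (T ⊗[k] T) ⊗[k] N →ₗ[k] A) : Prop :=
  IsRegMeas2 f ∧ MeasCocycle2 μ f

/-- The measuring coboundary
`(t ⊗ s ⊗ n) ↦ ∑ g(s₍₁₎)(n₍₁₎) g⁻¹(t₍₁₎s₍₂₎)(n₍₂₎) g(t₍₂₎)(s₍₃₎(n₍₃₎))`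
of a 1-cochain `g` with convolution inverse `ginv`.  (For a 2-cocycle `f` on `N` with
stability witness `g`, this same formula is the map `d`. ) -/
noncomputable def measCobound (μ : T ⊗[k] N →ₗ[k] N) (g ginv : T ⊗[k] N →ₗ[k] A) :
    (T ⊗[k] T) ⊗[k] N →ₗ[k] A :=
  conv (g ∘ₗ LinearMap.rTensor N (dropL T T))
    (conv (ginv ∘ₗ LinearMap.rTensor N (LinearMap.mul' k T))
          (g ∘ₗ LinearMap.lTensor T μ ∘ₗ (TensorProduct.assoc k T T N).toLinearMap))

/-- Measuring 2-coboundaries. -/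
def IsMeasB2 (μ : T ⊗[k] N →ₗ[k] N) (f : (T ⊗[k] T) ⊗[k] N →ₗ[k] A) : Prop :=
  ∃ g ginv : T ⊗[k] N →ₗ[k] A, IsRegMeas1 g ∧ IsConvInv g ginv ∧ f = measCobound μ g ginv

/-- Cohomologous measuring 2-cochains. -/
def MeasCohomologous2 (μ : T ⊗[k] N →ₗ[k] N) (f f' : (T ⊗[k] T) ⊗[k] N →ₗ[k] A) : Prop :=
  ∃ b, IsMeasB2 μ b ∧ f = conv f' b

/-- `∑ f(n₍₁₎ ⊗ n'₍₁₎) f⁻¹(t₍₁₎(n₍₂₎) ⊗ t₍₂₎(n'₍₂₎))` as a map `T ⊗ (N ⊗ N) → A`. -/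
noncomputable def stabLHS (μ : T ⊗[k] N →ₗ[k] N) (f finv : N ⊗[k] N →ₗ[k] A) :
    T ⊗[k] (N ⊗[k] N) →ₗ[k] A :=
  conv (f ∘ₗ dropL T (N ⊗[k] N))
       (finv ∘ₗ TensorProduct.map μ μ
          ∘ₗ (TensorProduct.tensorTensorTensorComm k T T N N).toLinearMap
          ∘ₗ LinearMap.rTensor (N ⊗[k] N) Coalgebra.comul)

/-- `∑ g(t₍₁₎ ⊗ n₍₁₎) g⁻¹(t₍₂₎ ⊗ n₍₂₎n'₍₁₎) g(t₍₃₎ ⊗ n'₍₂₎)` as a map `T ⊗ (N ⊗ N) → A`. -/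
noncomputable def stabRHS (g ginv : T ⊗[k] N →ₗ[k] A) : T ⊗[k] (N ⊗[k] N) →ₗ[k] A :=
  conv (g ∘ₗ LinearMap.lTensor T (dropR N N))
    (conv (ginv ∘ₗ LinearMap.lTensor T (LinearMap.mul' k N))
          (g ∘ₗ LinearMap.lTensor T (dropL N N)))

/-- `g` (with convolution inverse `ginv`) witnesses the `T`-stability of the
2-cochain `f` on `N` (with convolution inverse `finv`):
`f * (f⁻¹)ᵗ = δ'(g(t ⊗ _))`. -/
def IsStabilityWitness (μ : T ⊗[k] N →ₗ[k] N) (f finv : N ⊗[k] N →ₗ[k] A)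
    (g ginv : T ⊗[k] N →ₗ[k] A) : Prop :=
  MeasNormalized1 g ∧ (∀ t : T, g (t ⊗ₜ[k] (1 : N)) = algebraMap k A (Coalgebra.counit t))
    ∧ IsConvInv g ginv ∧ stabLHS μ f finv = stabRHS g ginv

/-- The cohomology class of the 2-cocycle `f` on `N` is `T`-stable. -/
def IsTStable (μ : T ⊗[k] N →ₗ[k] N) (f finv : N ⊗[k] N →ₗ[k] A) : Prop :=
  ∃ g ginv, IsStabilityWitness μ f finv g ginv

end MeasCohomology

section SmashStatements

variable {k : Type} [Field k]
variable {T N H A : Type} [Ring T] [Bialgebra k T] [Ring N] [Bialgebra k N]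
  [Ring H] [Bialgebra k H] [CommRing A] [Algebra k A]

/-- `n ⊗ t ↦ (n ⋊ 1)(1 ⋊ t) = n ⋊ t`. -/
noncomputable def smashMul (iN : N →ₐc[k] H) (iT : T →ₐc[k] H) : N ⊗[k] T →ₗ[k] H :=
  LinearMap.mul' k H ∘ₗ TensorProduct.map iN.toLinearMap iT.toLinearMap

/-- The restriction of a 2-cochain on `H` to `N ⊗ N`. -/
noncomputable def resNN (iN : N →ₐc[k] H) (f : H ⊗[k] H →ₗ[k] A) : N ⊗[k] N →ₗ[k] A :=
  f ∘ₗ TensorProduct.map iN.toLinearMap iN.toLinearMap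

/-- The restriction of a 2-cochain on `H` to `T ⊗ T`. -/
noncomputable def resTT (iT : T →ₐc[k] H) (f : H ⊗[k] H →ₗ[k] A) : T ⊗[k] T →ₗ[k] A :=
  f ∘ₗ TensorProduct.map iT.toLinearMap iT.toLinearMap

/-- The restriction of a 2-cochain on `H` to `T ⊗ N`. -/
noncomputable def resTN (iN : N →ₐc[k] H) (iT : T →ₐc[k] H) (f : H ⊗[k] H →ₗ[k] A) :
    T ⊗[k] N →ₗ[k] A :=
  f ∘ₗ TensorProduct.map iT.toLinearMap iN.toLinearMap

/-- `f` is trivial on `N ⊗ T`: `f(n ⊗ t) = ε(n)ε(t)1`. -/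
def TrivialOnNT (iN : N →ₐc[k] H) (iT : T →ₐc[k] H) (f : H ⊗[k] H →ₗ[k] A) : Prop :=
  ∀ (n : N) (t : T), f (iN n ⊗ₜ[k] iT t)
    = algebraMap k A (Coalgebra.counit n * Coalgebra.counit t)

/-- `f` is trivial on `T ⊗ T`. -/
def TrivialOnTT (iT : T →ₐc[k] H) (f : H ⊗[k] H →ₗ[k] A) : Prop :=
  ∀ t t' : T, f (iT t ⊗ₜ[k] iT t')
    = algebraMap k A (Coalgebra.counit t * Coalgebra.counit t')

/-- `F` is the 2-cochain `ι f : (n ⋊ t) ⊗ (n' ⋊ t') ↦ ε(n) f(t)(n') ε(t')` on `H`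
associated with a measuring 1-cochain `f`. -/
def IotaOf (iN : N →ₐc[k] H) (iT : T →ₐc[k] H) (f : T ⊗[k] N →ₗ[k] A)
    (F : H ⊗[k] H →ₗ[k] A) : Prop :=
  ∀ (n : N) (t : T) (n' : N) (t' : T),
    F ((iN n * iT t) ⊗ₜ[k] (iN n' * iT t'))
      = algebraMap k A (Coalgebra.counit n * Coalgebra.counit t') * f (t ⊗ₜ[k] n')

/-- `J` is the 3-cochain
`jf : (n⋊t) ⊗ (n'⋊t') ⊗ (n''⋊t'') ↦ ε(n)ε(n') f(t⊗t')(n'') ε(t'')` on `H`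
associated with a measuring 2-cochain `f`. -/
def JOf (iN : N →ₐc[k] H) (iT : T →ₐc[k] H) (f : (T ⊗[k] T) ⊗[k] N →ₗ[k] A)
    (J : (H ⊗[k] H) ⊗[k] H →ₗ[k] A) : Prop :=
  ∀ (n : N) (t : T) (n' : N) (t' : T) (n'' : N) (t'' : T),
    J (((iN n * iT t) ⊗ₜ[k] (iN n' * iT t')) ⊗ₜ[k] (iN n'' * iT t''))
      = algebraMap k A (Coalgebra.counit n * Coalgebra.counit n' * Coalgebra.counit t'')
          * f ((t ⊗ₜ[k] t') ⊗ₜ[k] n'')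

end SmashStatements

end SmashPaper

open TensorProduct SmashPaper

namespace SmashPaper

section CochainGroup

variable {k : Type} [Field k] {C D E : Type} [AddCommGroup C] [Module k C] [Coalgebra k C]
  [AddCommGroup D] [Module k D] [Coalgebra k D] [AddCommGroup E] [Module k E] [Coalgebra k E]
  {A : Type} [CommRing A] [Algebra k A]

variable (k C A) in
/-- The group of convolution-invertible linear maps from a coalgebra to an algebra. -/
abbrev Reg : Type := (WithConv (C →ₗ[k] A))ˣ

/-- The linear map underlying an element of `Reg k C A`. -/
def Reg.toLin (u : Reg k C A) : C →ₗ[k] A := u.val.ofConv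

theorem Reg.toLin_injective : Function.Injective (Reg.toLin : Reg k C A → C →ₗ[k] A) :=
  fun _ _ h => Units.ext (WithConv.ofConv_injective h)

@[simp]
theorem Reg.toLin_mul (u v : Reg k C A) : (u * v).toLin = conv u.toLin v.toLin := rfl

@[simp]
theorem Reg.toLin_one : (1 : Reg k C A).toLin = convOne C A := rfl

theorem isConvInv_iff (f g : C →ₗ[k] A) :
    IsConvInv f g ↔ ∃ u : Reg k C A, u.toLin = f ∧ u⁻¹.toLin = g := by
  constructor
  · rintro ⟨h, h'⟩
    exact ⟨⟨.toConv f, .toConv g, WithConv.ofConv_injective h, WithConv.ofConv_injective h'⟩,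
      rfl, rfl⟩
  · rintro ⟨u, rfl, rfl⟩
    exact ⟨by rw [← Reg.toLin_mul, mul_inv_cancel, Reg.toLin_one],
      by rw [← Reg.toLin_mul, inv_mul_cancel, Reg.toLin_one]⟩

theorem isConvInvertible_iff (f : C →ₗ[k] A) :
    IsConvInvertible f ↔ ∃ u : Reg k C A, u.toLin = f := by
  simp only [IsConvInvertible, isConvInv_iff]
  exact ⟨fun ⟨_, u, hu, _⟩ => ⟨u, hu⟩, fun ⟨u, hu⟩ => ⟨_, u, hu, rfl⟩⟩

/-- Precomposition with a coalgebra morphism is multiplicative for convolution. -/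
noncomputable def Reg.pullback (φ : C →ₗc[k] D) : Reg k D A →* Reg k C A :=
  Units.map
    { toFun := fun f => .toConv (f.ofConv ∘ₗ φ.toLinearMap)
      map_one' := by
        ext x
        simp [LinearMap.convOne_def]
      map_mul' := fun f g =>
        WithConv.ofConv_injective (LinearMap.convMul_comp_coalgHom_distrib f g φ) }

theorem Reg.toLin_pullback (φ : C →ₗc[k] D) (u : Reg k D A) :
    (Reg.pullback φ u).toLin = u.toLin ∘ₗ φ.toLinearMap := rfl

theorem Reg.pullback_pullback (φ : C →ₗc[k] D) (ψ : D →ₗc[k] E) (u : Reg k E A) :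
    Reg.pullback φ (Reg.pullback ψ u) = Reg.pullback (ψ.comp φ) u := rfl

theorem Reg.pullback_id (u : Reg k C A) : Reg.pullback (CoalgHom.id k C) u = u := rfl

theorem Reg.pullback_eq_one_iff (φ : C →ₗc[k] D) (u : Reg k D A) :
    Reg.pullback φ u = 1 ↔ ∀ x, u.toLin (φ x) = algebraMap k A (Coalgebra.counit x) := by
  rw [← Reg.toLin_injective.eq_iff, LinearMap.ext_iff]
  rfl

end CochainGroup

section Faces

variable {k : Type} [Field k]

section Drop

variable (C D : Type) [AddCommGroup C] [Module k C] [Coalgebra k C]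
  [AddCommGroup D] [Module k D] [Coalgebra k D]

/-- `dropL` as a coalgebra morphism. -/
noncomputable def dropLHom : C ⊗[k] D →ₗc[k] D :=
  (Coalgebra.TensorProduct.lid k D).toCoalgHom.comp
    (CoalgHom.rTensor D (Coalgebra.counitCoalgHom k C))

/-- `dropR` as a coalgebra morphism. -/
noncomputable def dropRHom : C ⊗[k] D →ₗc[k] C :=
  (Coalgebra.TensorProduct.rid k k C).toCoalgHom.comp
    (CoalgHom.lTensor C (Coalgebra.counitCoalgHom k D))

end Drop

variable (k) (H : Type) [Ring H] [Bialgebra k H]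

/-- The face maps `H ⊗ H → H` of the bar construction. -/
noncomputable def face₂ : Fin 3 → (H ⊗[k] H →ₗc[k] H) :=
  ![dropLHom H H, Bialgebra.mulCoalgHom k H, dropRHom H H]

/-- The face maps `H ⊗ H ⊗ H → H ⊗ H` of the bar construction. -/
noncomputable def face₃ : Fin 4 → ((H ⊗[k] H) ⊗[k] H →ₗc[k] H ⊗[k] H) :=
  ![(dropLHom H (H ⊗[k] H)).comp (Coalgebra.TensorProduct.assoc k k H H H).toCoalgHom,
    CoalgHom.rTensor H (Bialgebra.mulCoalgHom k H),
    (CoalgHom.lTensor H (Bialgebra.mulCoalgHom k H)).comp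
      (Coalgebra.TensorProduct.assoc k k H H H).toCoalgHom,
    dropRHom (H ⊗[k] H) H]

/-- The face maps `H ⊗ H ⊗ H ⊗ H → H ⊗ H ⊗ H` of the bar construction. -/
noncomputable def face₄ :
    Fin 5 → (((H ⊗[k] H) ⊗[k] H) ⊗[k] H →ₗc[k] (H ⊗[k] H) ⊗[k] H) :=
  ![CoalgHom.rTensor H (CoalgHom.rTensor H (dropLHom H H)),
    CoalgHom.rTensor H (CoalgHom.rTensor H (Bialgebra.mulCoalgHom k H)),
    CoalgHom.rTensor H (face₃ k H 2),
    (CoalgHom.lTensor (H ⊗[k] H) (Bialgebra.mulCoalgHom k H)).comp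
      (Coalgebra.TensorProduct.assoc k k (H ⊗[k] H) H H).toCoalgHom,
    dropRHom ((H ⊗[k] H) ⊗[k] H) H]

/-- The inclusion of the scalars. -/
noncomputable def degen₁ : k →ₗc[k] H := (Bialgebra.unitBialgHom k H).toCoalgHom

/-- The degeneracies `H → H ⊗ H`. -/
noncomputable def degen₂ : Fin 2 → (H →ₗc[k] H ⊗[k] H) :=
  ![(CoalgHom.rTensor H (degen₁ k H)).comp (Coalgebra.TensorProduct.lid k H).symm.toCoalgHom,
    (CoalgHom.lTensor H (degen₁ k H)).comp (Coalgebra.TensorProduct.rid k k H).symm.toCoalgHom]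

/-- The degeneracies `H ⊗ H → H ⊗ H ⊗ H`. -/
noncomputable def degen₃ : Fin 3 → (H ⊗[k] H →ₗc[k] (H ⊗[k] H) ⊗[k] H) :=
  ![CoalgHom.rTensor H (degen₂ k H 0), CoalgHom.rTensor H (degen₂ k H 1),
    (CoalgHom.lTensor (H ⊗[k] H) (degen₁ k H)).comp
      (Coalgebra.TensorProduct.rid k k (H ⊗[k] H)).symm.toCoalgHom]

end Faces

section Naturality

variable {k : Type} [Field k] {K H : Type} [Ring K] [Bialgebra k K] [Ring H] [Bialgebra k H]

/-- `φ ⊗ φ` as a coalgebra morphism. -/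
noncomputable def map₂ (φ : K →ₐc[k] H) : K ⊗[k] K →ₗc[k] H ⊗[k] H :=
  Coalgebra.TensorProduct.map φ.toCoalgHom φ.toCoalgHom

/-- `φ ⊗ φ ⊗ φ` as a coalgebra morphism. -/
noncomputable def map₃ (φ : K →ₐc[k] H) : (K ⊗[k] K) ⊗[k] K →ₗc[k] (H ⊗[k] H) ⊗[k] H :=
  Coalgebra.TensorProduct.map (map₂ φ) φ.toCoalgHom

/-- `φ ⊗ φ ⊗ φ ⊗ φ` as a coalgebra morphism. -/
noncomputable def map₄ (φ : K →ₐc[k] H) :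
    ((K ⊗[k] K) ⊗[k] K) ⊗[k] K →ₗc[k] ((H ⊗[k] H) ⊗[k] H) ⊗[k] H :=
  Coalgebra.TensorProduct.map (map₃ φ) φ.toCoalgHom

theorem coalgHom_ext_toLinearMap {C D : Type} [AddCommGroup C] [Module k C] [Coalgebra k C]
    [AddCommGroup D] [Module k D] [Coalgebra k D] {f g : C →ₗc[k] D}
    (h : f.toLinearMap = g.toLinearMap) : f = g :=
  CoalgHom.ext fun x => LinearMap.congr_fun h x

theorem toCoalgHom_apply (φ : K →ₐc[k] H) (x : K) : φ.toCoalgHom x = φ x := rfl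

theorem degen₁_one : degen₁ k H 1 = 1 := map_one (Bialgebra.unitBialgHom k H)

theorem face₂_natural (φ : K →ₐc[k] H) (i : Fin 3) :
    (face₂ k H i).comp (map₂ φ) = φ.toCoalgHom.comp (face₂ k K i) := by
  apply coalgHom_ext_toLinearMap
  fin_cases i <;> ext x y <;> simp [toCoalgHom_apply, face₂, map₂, dropLHom, dropRHom]

theorem face₃_natural (φ : K →ₐc[k] H) (i : Fin 4) :
    (face₃ k H i).comp (map₃ φ) = (map₂ φ).comp (face₃ k K i) := by
  apply coalgHom_ext_toLinearMap
  fin_cases i <;> ext x y z <;> simp [toCoalgHom_apply, face₃, map₂, map₃, dropLHom, dropRHom]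

theorem face₄_natural (φ : K →ₐc[k] H) (i : Fin 5) :
    (face₄ k H i).comp (map₄ φ) = (map₃ φ).comp (face₄ k K i) := by
  refine coalgHom_ext_toLinearMap (C := ((K ⊗[k] K) ⊗[k] K) ⊗[k] K)
    (D := (H ⊗[k] H) ⊗[k] H) ?_
  fin_cases i <;> ext x y z w <;>
    simp [toCoalgHom_apply, face₃, face₄, map₂, map₃, map₄, dropLHom, dropRHom]

theorem degen₁_natural (φ : K →ₐc[k] H) :
    φ.toCoalgHom.comp (degen₁ k K) = degen₁ k H := by
  apply coalgHom_ext_toLinearMap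
  ext; simp [toCoalgHom_apply, degen₁_one]

theorem degen₂_natural (φ : K →ₐc[k] H) (i : Fin 2) :
    (map₂ φ).comp (degen₂ k K i) = (degen₂ k H i).comp φ.toCoalgHom := by
  apply coalgHom_ext_toLinearMap
  fin_cases i <;> ext x <;> simp [toCoalgHom_apply, degen₁_one, degen₂, map₂]

theorem degen₃_natural (φ : K →ₐc[k] H) (i : Fin 3) :
    (map₃ φ).comp (degen₃ k K i) = (degen₃ k H i).comp (map₂ φ) := by
  apply coalgHom_ext_toLinearMap
  fin_cases i <;> ext x y <;> simp [toCoalgHom_apply, degen₁_one, degen₂, degen₃, map₂, map₃]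

end Naturality

section Normalized

variable (k : Type) [Field k] (H A : Type) [Ring H] [Bialgebra k H] [CommRing A] [Algebra k A]

/-- Normalized 1-cochains. -/
noncomputable def norm₁ : Subgroup (Reg k H A) := (Reg.pullback (degen₁ k H)).ker

/-- Normalized 2-cochains. -/
noncomputable def norm₂ : Subgroup (Reg k (H ⊗[k] H) A) :=
  ⨅ i, (Reg.pullback (degen₂ k H i)).ker

/-- Normalized 3-cochains. -/
noncomputable def norm₃ : Subgroup (Reg k ((H ⊗[k] H) ⊗[k] H) A) :=
  ⨅ i, (Reg.pullback (degen₃ k H i)).ker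

variable {k H A}

theorem mem_norm₁_iff (u : Reg k H A) : u ∈ norm₁ k H A ↔ Normalized1 u.toLin := by
  rw [norm₁, MonoidHom.mem_ker, Reg.pullback_eq_one_iff, Normalized1]
  refine ⟨fun h => by simpa [degen₁_one] using h 1, fun h x => ?_⟩
  rw [← mul_one x, ← smul_eq_mul, map_smul, degen₁_one, map_smul, h]
  simp [Algebra.algebraMap_eq_smul_one]

theorem mem_norm₂_iff (u : Reg k (H ⊗[k] H) A) :
    u ∈ norm₂ k H A ↔ Normalized2 u.toLin := by
  simp only [norm₂, Subgroup.mem_iInf, Fin.forall_fin_two, MonoidHom.mem_ker,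
    Reg.pullback_eq_one_iff, Normalized2, ← forall_and]
  simp [degen₂, degen₁_one]

theorem mem_norm₃_iff (u : Reg k ((H ⊗[k] H) ⊗[k] H) A) :
    u ∈ norm₃ k H A ↔ Normalized3 u.toLin := by
  have key (φ : H ⊗[k] H →ₗc[k] (H ⊗[k] H) ⊗[k] H) : Reg.pullback φ u = 1 ↔
      ∀ x y : H, u.toLin (φ (x ⊗ₜ y))
        = algebraMap k A (Coalgebra.counit x * Coalgebra.counit y) := by
    rw [Reg.pullback_eq_one_iff]
    refine ⟨fun h x y => by simp [h, mul_comm], fun h x => ?_⟩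
    induction x with
    | zero => simp
    | add a b ha hb => simp [ha, hb]
    | tmul a b => simp [h, mul_comm]
  simp only [norm₃, Subgroup.mem_iInf, Fin.forall_fin_succ, MonoidHom.mem_ker, key, Normalized3,
    forall_and]
  simp [degen₃, degen₂, degen₁_one]

end Normalized

section Cohomology

variable (k : Type) [Field k] (H A : Type) [Ring H] [Bialgebra k H] [CommRing A] [Algebra k A]
  [Coalgebra.IsCocomm k H]

/-- The Sweedler differential from 1-cochains to 2-cochains. -/
noncomputable def diff₁ : Reg k H A →* Reg k (H ⊗[k] H) A :=
  Reg.pullback (face₂ k H 0) * ((Reg.pullback (face₂ k H 1))⁻¹ * Reg.pullback (face₂ k H 2))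

/-- The Sweedler differential from 2-cochains to 3-cochains. -/
noncomputable def diff₂ : Reg k (H ⊗[k] H) A →* Reg k ((H ⊗[k] H) ⊗[k] H) A :=
  Reg.pullback (face₃ k H 0) * ((Reg.pullback (face₃ k H 1))⁻¹ *
    (Reg.pullback (face₃ k H 2) * (Reg.pullback (face₃ k H 3))⁻¹))

/-- The group of Sweedler 2-cocycles. -/
noncomputable def Z₂ : Subgroup (Reg k (H ⊗[k] H) A) :=
  norm₂ k H A ⊓ (Reg.pullback (face₃ k H 3) * Reg.pullback (face₃ k H 1)).eqLocus
    (Reg.pullback (face₃ k H 0) * Reg.pullback (face₃ k H 2))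

/-- The group of Sweedler 2-coboundaries. -/
noncomputable def B₂ : Subgroup (Reg k (H ⊗[k] H) A) := (norm₁ k H A).map (diff₁ k H A)

/-- Pullback of 3-cochains along the face maps `H ⊗ H ⊗ H ⊗ H → H ⊗ H ⊗ H`. -/
noncomputable def pullFace₄ (i : Fin 5) :
    Reg k ((H ⊗[k] H) ⊗[k] H) A →* Reg k (((H ⊗[k] H) ⊗[k] H) ⊗[k] H) A :=
  Reg.pullback (C := ((H ⊗[k] H) ⊗[k] H) ⊗[k] H) (face₄ k H i)

/-- The group of Sweedler 3-cocycles. -/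
noncomputable def Z₃ : Subgroup (Reg k ((H ⊗[k] H) ⊗[k] H) A) :=
  norm₃ k H A ⊓ MonoidHom.eqLocus
    (pullFace₄ k H A 0 * (pullFace₄ k H A 2 * pullFace₄ k H A 4))
    (pullFace₄ k H A 1 * pullFace₄ k H A 3)

/-- The group of Sweedler 3-coboundaries. -/
noncomputable def B₃ : Subgroup (Reg k ((H ⊗[k] H) ⊗[k] H) A) := (norm₂ k H A).map (diff₂ k H A)

variable {k H A}

theorem toLin_diff₁ (u : Reg k H A) :
    (diff₁ k H A u).toLin = cobound2 u.toLin u⁻¹.toLin := by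
  simp only [diff₁, MonoidHom.mul_apply, MonoidHom.inv_apply, ← map_inv, Reg.toLin_mul,
    Reg.toLin_pullback]
  rfl

theorem toLin_diff₂ (u : Reg k (H ⊗[k] H) A) :
    (diff₂ k H A u).toLin = cobound3 u.toLin u⁻¹.toLin := by
  simp only [diff₂, MonoidHom.mul_apply, MonoidHom.inv_apply, ← map_inv, Reg.toLin_mul,
    Reg.toLin_pullback]
  rfl

theorem mem_Z₂_iff (u : Reg k (H ⊗[k] H) A) : u ∈ Z₂ k H A ↔ IsZ2 u.toLin := by
  have hu : IsConvInvertible u.toLin := (isConvInvertible_iff _).2 ⟨u, rfl⟩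
  rw [Z₂, Subgroup.mem_inf, mem_norm₂_iff, IsZ2, and_iff_right hu]
  refine and_congr_right fun _ => Reg.toLin_injective.eq_iff.symm.trans ?_
  rfl

theorem mem_Z₃_iff (u : Reg k ((H ⊗[k] H) ⊗[k] H) A) : u ∈ Z₃ k H A ↔ IsZ3 u.toLin := by
  have hu : IsConvInvertible u.toLin := (isConvInvertible_iff _).2 ⟨u, rfl⟩
  rw [Z₃, Subgroup.mem_inf, mem_norm₃_iff, IsZ3, and_iff_right hu]
  refine and_congr_right fun _ => Reg.toLin_injective.eq_iff.symm.trans ?_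
  rfl

theorem isZ2_iff (f : H ⊗[k] H →ₗ[k] A) : IsZ2 f ↔ ∃ u ∈ Z₂ k H A, u.toLin = f := by
  constructor
  · intro h
    obtain ⟨u, rfl⟩ := (isConvInvertible_iff f).1 h.2.1
    exact ⟨u, (mem_Z₂_iff u).2 h, rfl⟩
  · rintro ⟨u, hu, rfl⟩
    exact (mem_Z₂_iff u).1 hu

theorem isZ3_iff (f : (H ⊗[k] H) ⊗[k] H →ₗ[k] A) :
    IsZ3 f ↔ ∃ u ∈ Z₃ k H A, u.toLin = f := by
  constructor
  · intro h
    obtain ⟨u, rfl⟩ := (isConvInvertible_iff f).1 h.2.1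
    exact ⟨u, (mem_Z₃_iff u).2 h, rfl⟩
  · rintro ⟨u, hu, rfl⟩
    exact (mem_Z₃_iff u).1 hu

theorem isB2_iff (f : H ⊗[k] H →ₗ[k] A) : IsB2 f ↔ ∃ u ∈ B₂ k H A, u.toLin = f := by
  constructor
  · rintro ⟨t, t', ht, htt', rfl⟩
    obtain ⟨u, rfl, rfl⟩ := (isConvInv_iff t t').1 htt'
    exact ⟨_, ⟨u, (mem_norm₁_iff u).2 ht, rfl⟩, toLin_diff₁ u⟩
  · rintro ⟨_, ⟨u, hu, rfl⟩, rfl⟩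
    exact ⟨_, _, (mem_norm₁_iff u).1 hu, (isConvInv_iff _ _).2 ⟨u, rfl, rfl⟩, toLin_diff₁ u⟩

theorem isB3_iff (f : (H ⊗[k] H) ⊗[k] H →ₗ[k] A) :
    IsB3 f ↔ ∃ u ∈ B₃ k H A, u.toLin = f := by
  constructor
  · rintro ⟨t, t', ht, htt', rfl⟩
    obtain ⟨u, rfl, rfl⟩ := (isConvInv_iff t t').1 htt'
    exact ⟨_, ⟨u, (mem_norm₂_iff u).2 ht, rfl⟩, toLin_diff₂ u⟩
  · rintro ⟨_, ⟨u, hu, rfl⟩, rfl⟩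
    exact ⟨_, _, (mem_norm₂_iff u).1 hu, (isConvInv_iff _ _).2 ⟨u, rfl, rfl⟩, toLin_diff₂ u⟩

theorem mem_B₂_iff (u : Reg k (H ⊗[k] H) A) : u ∈ B₂ k H A ↔ IsB2 u.toLin := by
  rw [isB2_iff]
  exact ⟨fun h => ⟨u, h, rfl⟩, fun ⟨_, h, e⟩ => Reg.toLin_injective e ▸ h⟩

theorem mem_B₃_iff (u : Reg k ((H ⊗[k] H) ⊗[k] H) A) : u ∈ B₃ k H A ↔ IsB3 u.toLin := by
  rw [isB3_iff]
  exact ⟨fun h => ⟨u, h, rfl⟩, fun ⟨_, h, e⟩ => Reg.toLin_injective e ▸ h⟩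

theorem cohomologous2_iff (u v : Reg k (H ⊗[k] H) A) :
    Cohomologous2 u.toLin v.toLin ↔ ∃ b ∈ B₂ k H A, u = v * b := by
  simp only [Cohomologous2, isB2_iff]
  constructor
  · rintro ⟨_, ⟨b, hb, rfl⟩, h⟩
    exact ⟨b, hb, Reg.toLin_injective h⟩
  · rintro ⟨b, hb, rfl⟩
    exact ⟨_, ⟨b, hb, rfl⟩, rfl⟩

theorem cohomologous3_iff (u v : Reg k ((H ⊗[k] H) ⊗[k] H) A) :
    Cohomologous3 u.toLin v.toLin ↔ ∃ b ∈ B₃ k H A, u = v * b := by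
  simp only [Cohomologous3, isB3_iff]
  constructor
  · rintro ⟨_, ⟨b, hb, rfl⟩, h⟩
    exact ⟨b, hb, Reg.toLin_injective h⟩
  · rintro ⟨b, hb, rfl⟩
    exact ⟨_, ⟨b, hb, rfl⟩, rfl⟩

end Cohomology

section Functoriality

variable {k : Type} [Field k] {K H A : Type} [Ring K] [Bialgebra k K] [Ring H] [Bialgebra k H]
  [CommRing A] [Algebra k A]

theorem pullback_mem_norm₁ (φ : K →ₐc[k] H) {u : Reg k H A} (hu : u ∈ norm₁ k H A) :
    Reg.pullback φ.toCoalgHom u ∈ norm₁ k K A := by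
  rw [norm₁, MonoidHom.mem_ker] at hu ⊢
  rw [Reg.pullback_pullback, degen₁_natural, hu]

theorem pullback_mem_norm₂ (φ : K →ₐc[k] H) {u : Reg k (H ⊗[k] H) A} (hu : u ∈ norm₂ k H A) :
    Reg.pullback (map₂ φ) u ∈ norm₂ k K A := by
  simp only [norm₂, Subgroup.mem_iInf, MonoidHom.mem_ker] at hu ⊢
  intro i
  rw [Reg.pullback_pullback, degen₂_natural, ← Reg.pullback_pullback, hu, map_one]

theorem pullback_mem_norm₃ (φ : K →ₐc[k] H) {u : Reg k ((H ⊗[k] H) ⊗[k] H) A}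
    (hu : u ∈ norm₃ k H A) : Reg.pullback (map₃ φ) u ∈ norm₃ k K A := by
  simp only [norm₃, Subgroup.mem_iInf, MonoidHom.mem_ker] at hu ⊢
  intro i
  rw [Reg.pullback_pullback, degen₃_natural, ← Reg.pullback_pullback, hu, map_one]

theorem pullback_pullFace₄ (φ : K →ₐc[k] H) (i : Fin 5) (u : Reg k ((H ⊗[k] H) ⊗[k] H) A) :
    Reg.pullback (C := ((K ⊗[k] K) ⊗[k] K) ⊗[k] K) (D := ((H ⊗[k] H) ⊗[k] H) ⊗[k] H) (map₄ φ)
      (pullFace₄ k H A i u) = pullFace₄ k K A i (Reg.pullback (map₃ φ) u) :=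
  congrArg (fun ψ => Reg.pullback (C := ((K ⊗[k] K) ⊗[k] K) ⊗[k] K) ψ u) (face₄_natural φ i)

variable [Coalgebra.IsCocomm k K] [Coalgebra.IsCocomm k H]

theorem pullback_mem_B₂ (φ : K →ₐc[k] H) {u : Reg k (H ⊗[k] H) A} (hu : u ∈ B₂ k H A) :
    Reg.pullback (map₂ φ) u ∈ B₂ k K A := by
  obtain ⟨t, ht, rfl⟩ := hu
  refine ⟨_, pullback_mem_norm₁ φ ht, ?_⟩
  simp only [diff₁, MonoidHom.mul_apply, MonoidHom.inv_apply, map_mul, map_inv,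
    Reg.pullback_pullback, face₂_natural]

theorem pullback_mem_B₃ (φ : K →ₐc[k] H) {u : Reg k ((H ⊗[k] H) ⊗[k] H) A}
    (hu : u ∈ B₃ k H A) : Reg.pullback (map₃ φ) u ∈ B₃ k K A := by
  obtain ⟨t, ht, rfl⟩ := hu
  refine ⟨_, pullback_mem_norm₂ φ ht, ?_⟩
  simp only [diff₂, MonoidHom.mul_apply, MonoidHom.inv_apply, map_mul, map_inv,
    Reg.pullback_pullback, face₃_natural]

theorem pullback_mem_Z₂ (φ : K →ₐc[k] H) {u : Reg k (H ⊗[k] H) A} (hu : u ∈ Z₂ k H A) :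
    Reg.pullback (map₂ φ) u ∈ Z₂ k K A := by
  refine ⟨pullback_mem_norm₂ φ hu.1, ?_⟩
  have h := congrArg (Reg.pullback (map₃ φ)) hu.2
  simp only [MonoidHom.mul_apply, map_mul, Reg.pullback_pullback, face₃_natural] at h
  exact h

theorem pullback_mem_Z₃ (φ : K →ₐc[k] H) {u : Reg k ((H ⊗[k] H) ⊗[k] H) A}
    (hu : u ∈ Z₃ k H A) : Reg.pullback (map₃ φ) u ∈ Z₃ k K A := by
  refine ⟨pullback_mem_norm₃ φ hu.1, ?_⟩
  have h := congrArg (Reg.pullback (C := ((K ⊗[k] K) ⊗[k] K) ⊗[k] K)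
    (D := ((H ⊗[k] H) ⊗[k] H) ⊗[k] H) (map₄ φ)) hu.2
  simp only [MonoidHom.mul_apply, map_mul, pullback_pullFace₄] at h
  exact h

end Functoriality

section SmashProjection

variable {k : Type} [Field k] {T N H : Type} [Ring T] [Bialgebra k T] [Ring N] [Bialgebra k N]
  [Ring H] [Bialgebra k H]

/-- `n ⊗ t ↦ n ⋊ t` as a coalgebra morphism. -/
noncomputable def smashHom (iN : N →ₐc[k] H) (iT : T →ₐc[k] H) : N ⊗[k] T →ₗc[k] H :=
  (Bialgebra.mulCoalgHom k H).comp
    (Coalgebra.TensorProduct.map iN.toCoalgHom iT.toCoalgHom)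

theorem smashHom_tmul (iN : N →ₐc[k] H) (iT : T →ₐc[k] H) (n : N) (t : T) :
    smashHom iN iT (n ⊗ₜ t) = iN n * iT t := rfl

theorem isCocomm_of_surjective {C D : Type} [AddCommGroup C] [Module k C] [Coalgebra k C]
    [AddCommGroup D] [Module k D] [Coalgebra k D] [Coalgebra.IsCocomm k C] (φ : C →ₗc[k] D)
    (hφ : Function.Surjective φ) : Coalgebra.IsCocomm k D where
  comm_comp_comul := by
    ext y
    obtain ⟨x, rfl⟩ := hφ y
    have h : Coalgebra.comul (R := k) (φ x)
        = TensorProduct.map φ.toLinearMap φ.toLinearMap (Coalgebra.comul x) :=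
      (LinearMap.congr_fun φ.map_comp_comul x).symm
    simp only [LinearMap.comp_apply, LinearEquiv.coe_coe]
    rw [h, ← TensorProduct.map_comm, Coalgebra.comm_comul]

theorem dropL_smashCross {μ : T ⊗[k] N →ₗ[k] N} (hμ : IsModuleBialgebra μ) (t : T) (n : N) :
    dropL N T (smashCross μ (t ⊗ₜ n)) = Coalgebra.counit (R := k) n • t := by
  have key (z : T ⊗[k] T) :
      dropL N T (TensorProduct.map μ LinearMap.id ((TensorProduct.assoc k T N T).symm
        (LinearMap.lTensor T (TensorProduct.comm k T N).toLinearMap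
          (TensorProduct.assoc k T T N (z ⊗ₜ n)))))
        = Coalgebra.counit (R := k) n • dropL T T z := by
    induction z with
    | zero => simp
    | add a b ha hb => simp only [TensorProduct.add_tmul, map_add, ha, hb, smul_add]
    | tmul a b =>
      simp only [dropL, TensorProduct.assoc_tmul, LinearMap.lTensor_tmul, LinearEquiv.coe_coe,
        TensorProduct.comm_tmul, TensorProduct.assoc_symm_tmul, TensorProduct.map_tmul,
        LinearMap.id_apply, LinearMap.comp_apply, LinearMap.rTensor_tmul, TensorProduct.lid_tmul,
        hμ.counit_act, smul_smul, mul_comm]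
  refine (key (Coalgebra.comul t)).trans ?_
  simp [dropL]

variable {μ : T ⊗[k] N →ₗ[k] N} {iN : N →ₐc[k] H} {iT : T →ₐc[k] H}

theorem IsSmashProduct.smashHom_smashCross (h : IsSmashProduct μ iN iT) (t : T) (n : N) :
    smashHom iN iT (smashCross μ (t ⊗ₜ n)) = iT t * iN n :=
  (LinearMap.congr_fun h.straighten (t ⊗ₜ n)).symm

/-- The smash product is the tensor product coalgebra. -/
noncomputable def IsSmashProduct.coalgEquiv (h : IsSmashProduct μ iN iT) : N ⊗[k] T ≃ₗc[k] H :=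
  CoalgEquiv.ofBijective (f := smashHom iN iT) h.bij

/-- The projection `n ⋊ t ↦ ε(n) t` as a coalgebra morphism. -/
noncomputable def IsSmashProduct.projCoalgHom (h : IsSmashProduct μ iN iT) : H →ₗc[k] T :=
  (dropLHom N T).comp h.coalgEquiv.symm.toCoalgHom

theorem IsSmashProduct.projCoalgHom_smashHom (h : IsSmashProduct μ iN iT) (z : N ⊗[k] T) :
    h.projCoalgHom (smashHom iN iT z) = dropL N T z :=
  congrArg (dropL N T) (h.coalgEquiv.symm_apply_apply z)

theorem IsSmashProduct.projCoalgHom_mul (h : IsSmashProduct μ iN iT) (n : N) (t : T) :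
    h.projCoalgHom (iN n * iT t) = Coalgebra.counit (R := k) n • t := by
  rw [← smashHom_tmul, h.projCoalgHom_smashHom]
  simp [dropL]

theorem IsSmashProduct.projCoalgHom_mul_mul (h : IsSmashProduct μ iN iT) (n : N)
    (z : N ⊗[k] T) (t : T) :
    h.projCoalgHom (iN n * smashHom iN iT z * iT t)
      = Coalgebra.counit (R := k) n • (dropL N T z * t) := by
  induction z with
  | zero => simp
  | add a b ha hb => simp only [map_add, mul_add, add_mul, ha, hb, smul_add]
  | tmul a b =>
    rw [smashHom_tmul, ← mul_assoc, mul_assoc (iN n * iN a), ← map_mul, ← map_mul,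
      h.projCoalgHom_mul]
    simp [dropL, mul_smul]

/-- The projection `n ⋊ t ↦ ε(n) t` as a bialgebra morphism. -/
noncomputable def IsSmashProduct.proj (h : IsSmashProduct μ iN iT) : H →ₐc[k] T where
  __ := h.projCoalgHom
  map_one' := by
    have h1 := h.projCoalgHom_mul 1 1
    rwa [map_one, map_one, one_mul, Bialgebra.counit_one, one_smul] at h1
  map_mul' x y := by
    obtain ⟨x, rfl⟩ := h.bij.2 x
    obtain ⟨y, rfl⟩ := h.bij.2 y
    change h.projCoalgHom (smashHom iN iT x * smashHom iN iT y)
      = h.projCoalgHom (smashHom iN iT x) * h.projCoalgHom (smashHom iN iT y)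
    induction x with
    | zero => simp
    | add a b ha hb => simp only [map_add, add_mul, ha, hb]
    | tmul n t =>
      induction y with
      | zero => simp
      | add a b ha hb => simp only [map_add, mul_add, ha, hb]
      | tmul n' t' =>
        rw [smashHom_tmul, smashHom_tmul, h.projCoalgHom_mul, h.projCoalgHom_mul,
          ← mul_assoc, mul_assoc (iN n), ← h.smashHom_smashCross, h.projCoalgHom_mul_mul,
          dropL_smashCross h.act]
        simp [smul_smul, mul_comm]

theorem IsSmashProduct.proj_mul (h : IsSmashProduct μ iN iT) (n : N) (t : T) :
    h.proj (iN n * iT t) = Coalgebra.counit (R := k) n • t :=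
  h.projCoalgHom_mul n t

theorem IsSmashProduct.proj_inclusion (h : IsSmashProduct μ iN iT) (t : T) :
    h.proj (iT t) = t := by
  simpa using h.proj_mul 1 t

end SmashProjection

section Splitting

theorem split_classes_unique {G K : Type} [CommGroup G] [CommGroup K] {p : K →* G} {r : G →* K}
    {BG : Subgroup G} {BK : Subgroup K} (hrp : ∀ x, r (p x) = x) (hp : ∀ x ∈ BK, p x ∈ BG)
    (hr : ∀ x ∈ BG, r x ∈ BK) {g g' : K} {h h' : G} (hh : r h ∈ BK) (hh' : r h' ∈ BK)
    (H : ∃ b ∈ BG, p g * h = p g' * h' * b) :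
    (∃ b ∈ BK, g = g' * b) ∧ ∃ b ∈ BG, h = h' * b := by
  obtain ⟨b, hb, e⟩ := H
  have e' : g * r h = g' * r h' * r b := by simpa [hrp] using congrArg r e
  have hc : r h' * r b * (r h)⁻¹ ∈ BK := mul_mem (mul_mem hh' (hr b hb)) (inv_mem hh)
  have hg : g = g' * (r h' * r b * (r h)⁻¹) := by
    rw [← mul_assoc, ← mul_assoc, ← e', mul_inv_cancel_right]
  refine ⟨⟨_, hc, hg⟩, _, mul_mem (inv_mem (hp _ hc)) hb, ?_⟩
  rw [hg, map_mul] at e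
  generalize p (r h' * r b * (r h)⁻¹) = c at e ⊢
  rw [mul_assoc, mul_assoc, mul_right_inj] at e
  rw [mul_left_comm, ← e, inv_mul_cancel_left]

variable {k : Type} [Field k] {T H A : Type} [Ring T] [Bialgebra k T] [Ring H] [Bialgebra k H]
  [CommRing A] [Algebra k A] {π : H →ₐc[k] T} {i : T →ₐc[k] H}

theorem map₂_comp_of_section (hπ : ∀ t, π (i t) = t) :
    (map₂ π).comp (map₂ i) = CoalgHom.id k (T ⊗[k] T) := by
  apply coalgHom_ext_toLinearMap
  ext x y
  simp [toCoalgHom_apply, map₂, hπ]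

theorem map₃_comp_of_section (hπ : ∀ t, π (i t) = t) :
    (map₃ π).comp (map₃ i) = CoalgHom.id k ((T ⊗[k] T) ⊗[k] T) := by
  apply coalgHom_ext_toLinearMap
  ext x y z
  simp [toCoalgHom_apply, map₂, map₃, hπ]

theorem pullback_map₂_of_section (hπ : ∀ t, π (i t) = t) (u : Reg k (T ⊗[k] T) A) :
    Reg.pullback (map₂ i) (Reg.pullback (map₂ π) u) = u := by
  rw [Reg.pullback_pullback, map₂_comp_of_section hπ, Reg.pullback_id]

theorem pullback_map₃_of_section (hπ : ∀ t, π (i t) = t) (u : Reg k ((T ⊗[k] T) ⊗[k] T) A) :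
    Reg.pullback (map₃ i) (Reg.pullback (map₃ π) u) = u := by
  rw [Reg.pullback_pullback, map₃_comp_of_section hπ, Reg.pullback_id]

variable [Coalgebra.IsCocomm k T] [Coalgebra.IsCocomm k H]

theorem exists_splitting₂ (hπ : ∀ t, π (i t) = t) {f : H ⊗[k] H →ₗ[k] A} (hf : IsZ2 f) :
    ∃ (g : T ⊗[k] T →ₗ[k] A) (h : H ⊗[k] H →ₗ[k] A), IsZ2 g ∧ IsZ2 h ∧
      IsB2 (h ∘ₗ TensorProduct.map i.toLinearMap i.toLinearMap) ∧
      Cohomologous2 f (conv (g ∘ₗ TensorProduct.map π.toLinearMap π.toLinearMap) h) := by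
  obtain ⟨u, hu, rfl⟩ := (isZ2_iff f).1 hf
  set v := Reg.pullback (map₂ i) u
  have hg : v ∈ Z₂ k T A := pullback_mem_Z₂ i hu
  set w := (Reg.pullback (map₂ π) v)⁻¹ * u with hw
  have hwZ : w ∈ Z₂ k H A := mul_mem (inv_mem (pullback_mem_Z₂ π hg)) hu
  have hres : Reg.pullback (map₂ i) w = 1 := by
    rw [hw, map_mul, map_inv, pullback_map₂_of_section hπ, inv_mul_cancel]
  have hres' : Reg.pullback (map₂ i) w ∈ B₂ k T A := hres ▸ one_mem _
  have hu' : u = Reg.pullback (map₂ π) v * w * 1 := by rw [mul_one, mul_inv_cancel_left]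
  exact ⟨v.toLin, w.toLin, (mem_Z₂_iff v).1 hg, (mem_Z₂_iff w).1 hwZ,
    (mem_B₂_iff _).1 hres', (cohomologous2_iff u (Reg.pullback (map₂ π) v * w)).2
      ⟨1, one_mem _, hu'⟩⟩

theorem splitting_unique₂ (hπ : ∀ t, π (i t) = t) {g g' : T ⊗[k] T →ₗ[k] A}
    {h h' : H ⊗[k] H →ₗ[k] A} (hg : IsZ2 g) (hg' : IsZ2 g') (hh : IsZ2 h) (hh' : IsZ2 h')
    (hb : IsB2 (h ∘ₗ TensorProduct.map i.toLinearMap i.toLinearMap))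
    (hb' : IsB2 (h' ∘ₗ TensorProduct.map i.toLinearMap i.toLinearMap))
    (hc : Cohomologous2 (conv (g ∘ₗ TensorProduct.map π.toLinearMap π.toLinearMap) h)
      (conv (g' ∘ₗ TensorProduct.map π.toLinearMap π.toLinearMap) h')) :
    Cohomologous2 g g' ∧ Cohomologous2 h h' := by
  obtain ⟨g, -, rfl⟩ := (isZ2_iff g).1 hg
  obtain ⟨g', -, rfl⟩ := (isZ2_iff g').1 hg'
  obtain ⟨h, -, rfl⟩ := (isZ2_iff h).1 hh
  obtain ⟨h', -, rfl⟩ := (isZ2_iff h').1 hh'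
  rw [cohomologous2_iff, cohomologous2_iff]
  exact split_classes_unique (pullback_map₂_of_section hπ) (fun _ => pullback_mem_B₂ π)
    (fun _ => pullback_mem_B₂ i) ((mem_B₂_iff (Reg.pullback (map₂ i) h)).2 hb)
    ((mem_B₂_iff (Reg.pullback (map₂ i) h')).2 hb')
    ((cohomologous2_iff (Reg.pullback (map₂ π) g * h)
      (Reg.pullback (map₂ π) g' * h')).1 hc)

theorem exists_splitting₃ (hπ : ∀ t, π (i t) = t) {f : (H ⊗[k] H) ⊗[k] H →ₗ[k] A} (hf : IsZ3 f) :
    ∃ (g : (T ⊗[k] T) ⊗[k] T →ₗ[k] A) (h : (H ⊗[k] H) ⊗[k] H →ₗ[k] A), IsZ3 g ∧ IsZ3 h ∧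
      IsB3 (h ∘ₗ TensorProduct.map
    (TensorProduct.map i.toLinearMap i.toLinearMap) i.toLinearMap) ∧
      Cohomologous3 f (conv (g ∘ₗ TensorProduct.map
    (TensorProduct.map π.toLinearMap π.toLinearMap) π.toLinearMap) h) := by
  obtain ⟨u, hu, rfl⟩ := (isZ3_iff f).1 hf
  set v := Reg.pullback (map₃ i) u
  have hg : v ∈ Z₃ k T A := pullback_mem_Z₃ i hu
  set w := (Reg.pullback (map₃ π) v)⁻¹ * u with hw
  have hwZ : w ∈ Z₃ k H A := mul_mem (inv_mem (pullback_mem_Z₃ π hg)) hu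
  have hres : Reg.pullback (map₃ i) w = 1 := by
    rw [hw, map_mul, map_inv, pullback_map₃_of_section hπ, inv_mul_cancel]
  have hres' : Reg.pullback (map₃ i) w ∈ B₃ k T A := hres ▸ one_mem _
  have hu' : u = Reg.pullback (map₃ π) v * w * 1 := by rw [mul_one, mul_inv_cancel_left]
  exact ⟨v.toLin, w.toLin, (mem_Z₃_iff v).1 hg, (mem_Z₃_iff w).1 hwZ,
    (mem_B₃_iff _).1 hres', (cohomologous3_iff u (Reg.pullback (map₃ π) v * w)).2
      ⟨1, one_mem _, hu'⟩⟩

theorem splitting_unique₃ (hπ : ∀ t, π (i t) = t) {g g' : (T ⊗[k] T) ⊗[k] T →ₗ[k] A}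
    {h h' : (H ⊗[k] H) ⊗[k] H →ₗ[k] A} (hg : IsZ3 g) (hg' : IsZ3 g') (hh : IsZ3 h) (hh' : IsZ3 h')
    (hb : IsB3 (h ∘ₗ TensorProduct.map
    (TensorProduct.map i.toLinearMap i.toLinearMap) i.toLinearMap))
    (hb' : IsB3 (h' ∘ₗ TensorProduct.map
    (TensorProduct.map i.toLinearMap i.toLinearMap) i.toLinearMap))
    (hc : Cohomologous3 (conv (g ∘ₗ TensorProduct.map
    (TensorProduct.map π.toLinearMap π.toLinearMap) π.toLinearMap) h)
      (conv (g' ∘ₗ TensorProduct.map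
    (TensorProduct.map π.toLinearMap π.toLinearMap) π.toLinearMap) h')) :
    Cohomologous3 g g' ∧ Cohomologous3 h h' := by
  obtain ⟨g, -, rfl⟩ := (isZ3_iff g).1 hg
  obtain ⟨g', -, rfl⟩ := (isZ3_iff g').1 hg'
  obtain ⟨h, -, rfl⟩ := (isZ3_iff h).1 hh
  obtain ⟨h', -, rfl⟩ := (isZ3_iff h').1 hh'
  rw [cohomologous3_iff, cohomologous3_iff]
  exact split_classes_unique (pullback_map₃_of_section hπ) (fun _ => pullback_mem_B₃ π)
    (fun _ => pullback_mem_B₃ i) ((mem_B₃_iff (Reg.pullback (map₃ i) h)).2 hb)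
    ((mem_B₃_iff (Reg.pullback (map₃ i) h')).2 hb')
    ((cohomologous3_iff (Reg.pullback (map₃ π) g * h)
      (Reg.pullback (map₃ π) g' * h')).1 hc)

end Splitting

end SmashPaper

/-- **Proposition (`Hⁱ(H,A) ≅ Hⁱ(T,A) ⊕ H̃ⁱ(H,A)` for `i = 2, 3`).**
Let `H = N ⋊ T` (cocommutative Hopf algebras over `k`) act trivially on the commutative
`k`-algebra `A`.  The canonical projection `π : H → T`, `π(n ⋊ t) = ε(n) t`, is a Hopf
(bi)algebra map splitting the inclusion `T → H`, and for `i = 2` and `i = 3` the induced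
splitting of the restriction map yields a direct sum decomposition
`Hⁱ(H,A) ≅ Hⁱ(T,A) ⊕ H̃ⁱ(H,A)` of Sweedler cohomology groups: every `i`-cocycle on `H`
decomposes, uniquely up to coboundaries, as the convolution of the pullback along `π` of
an `i`-cocycle on `T` with an `i`-cocycle on `H` whose restriction to `T` is a
coboundary. -/
theorem cohomology_splits_off_T
    {k : Type} [Field k] {T N H A : Type}
    [Ring T] [HopfAlgebra k T] [Ring N] [HopfAlgebra k N]
    [Ring H] [HopfAlgebra k H] [CommRing A] [Algebra k A]
    (hTcc : IsCocomm k T) (hNcc : IsCocomm k N)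
    (μ : T ⊗[k] N →ₗ[k] N) (iN : N →ₐc[k] H) (iT : T →ₐc[k] H)
    (hsmash : IsSmashProduct μ iN iT) :
    ∃ π : H →ₐc[k] T,
      (∀ (n : N) (t : T), π (iN n * iT t) = Coalgebra.counit (R := k) n • t)
      ∧ (∀ t : T, π (iT t) = t)
      -- decomposition in degree 2, existence
      ∧ (∀ f : H ⊗[k] H →ₗ[k] A, IsZ2 f →
          ∃ (g : T ⊗[k] T →ₗ[k] A) (h : H ⊗[k] H →ₗ[k] A),
            IsZ2 g ∧ IsZ2 h ∧ IsB2 (resTT iT h)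
              ∧ Cohomologous2 f
                  (conv (g ∘ₗ TensorProduct.map π.toLinearMap π.toLinearMap) h))
      -- decomposition in degree 2, uniqueness of the two classes
      ∧ (∀ (g g' : T ⊗[k] T →ₗ[k] A) (h h' : H ⊗[k] H →ₗ[k] A),
          IsZ2 g → IsZ2 g' → IsZ2 h → IsZ2 h' →
          IsB2 (resTT iT h) → IsB2 (resTT iT h') →
          Cohomologous2
            (conv (g ∘ₗ TensorProduct.map π.toLinearMap π.toLinearMap) h)
            (conv (g' ∘ₗ TensorProduct.map π.toLinearMap π.toLinearMap) h') →
          Cohomologous2 g g' ∧ Cohomologous2 h h')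
      -- decomposition in degree 3, existence
      ∧ (∀ f : (H ⊗[k] H) ⊗[k] H →ₗ[k] A, IsZ3 f →
          ∃ (g : (T ⊗[k] T) ⊗[k] T →ₗ[k] A) (h : (H ⊗[k] H) ⊗[k] H →ₗ[k] A),
            IsZ3 g ∧ IsZ3 h
              ∧ IsB3 (h ∘ₗ TensorProduct.map
                  (TensorProduct.map iT.toLinearMap iT.toLinearMap) iT.toLinearMap)
              ∧ Cohomologous3 f
                  (conv (g ∘ₗ TensorProduct.map
                      (TensorProduct.map π.toLinearMap π.toLinearMap) π.toLinearMap) h))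
      -- decomposition in degree 3, uniqueness of the two classes
      ∧ (∀ (g g' : (T ⊗[k] T) ⊗[k] T →ₗ[k] A) (h h' : (H ⊗[k] H) ⊗[k] H →ₗ[k] A),
          IsZ3 g → IsZ3 g' → IsZ3 h → IsZ3 h' →
          IsB3 (h ∘ₗ TensorProduct.map
              (TensorProduct.map iT.toLinearMap iT.toLinearMap) iT.toLinearMap) →
          IsB3 (h' ∘ₗ TensorProduct.map
              (TensorProduct.map iT.toLinearMap iT.toLinearMap) iT.toLinearMap) →
          Cohomologous3
            (conv (g ∘ₗ TensorProduct.map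
                (TensorProduct.map π.toLinearMap π.toLinearMap) π.toLinearMap) h)
            (conv (g' ∘ₗ TensorProduct.map
                (TensorProduct.map π.toLinearMap π.toLinearMap) π.toLinearMap) h') →
          Cohomologous3 g g' ∧ Cohomologous3 h h') := by
  have : Coalgebra.IsCocomm k T := ⟨hTcc⟩
  have : Coalgebra.IsCocomm k N := ⟨hNcc⟩
  have : Coalgebra.IsCocomm k H := isCocomm_of_surjective (smashHom iN iT) hsmash.bij.2
  have hπ := hsmash.proj_inclusion
  exact ⟨hsmash.proj, hsmash.proj_mul, hπ, fun _ => exists_splitting₂ hπ,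
    fun _ _ _ _ => splitting_unique₂ hπ, fun _ => exists_splitting₃ hπ,
    fun _ _ _ _ => splitting_unique₃ hπ⟩
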